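/- arXiv:2307.05989 — 3 statements merged into one kernel-verified Lean document; each statement's English description precedes it below -/
import Mathlib

section
/- Let λ₁ ≤ λ₂ ≤ λ₃ be real numbers with λ₁ + λ₂ + λ₃ = 0 and S = λ₁² + λ₂² + λ₃² > 0, and set F₃ = λ₁³ + λ₂³ + λ₃³. Then F₃ = −S^{3/2}/√6 if and only if λ₂ = λ₃, and F₃ = S^{3/2}/√6 if and only if λ₁ = λ₂. -/
/-- For zero-sum reals, `S³ − 6 F₃²` is twice the discriminant. -/
theorem sq_sum_cubed_sub_six_mul_cube_sum_sq {a b c : ℝ} (h : a + b + c = 0) :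
    (a ^ 2 + b ^ 2 + c ^ 2) ^ 3 - 6 * (a ^ 3 + b ^ 3 + c ^ 3) ^ 2
      = 2 * ((a - b) * (b - c) * (a - c)) ^ 2 := by
  obtain rfl : c = -a - b := by linarith
  ring

theorem rpow_three_halves_div_sqrt_six_sq {s : ℝ} (hs : 0 ≤ s) :
    6 * (s ^ ((3 : ℝ) / 2) / Real.sqrt 6) ^ 2 = s ^ 3 := by
  have h : (s ^ ((3 : ℝ) / 2)) ^ 2 = s ^ 3 := by
    rw [← Real.rpow_natCast, ← Real.rpow_mul hs, ← Real.rpow_natCast]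
    norm_num
  rw [div_pow, h, Real.sq_sqrt (by norm_num)]
  ring

/-- For ordered reals `λ₁ ≤ λ₂ ≤ λ₃` with zero sum and `S = Σλᵢ² > 0`,
`F₃ = −S^{3/2}/√6` iff `λ₂ = λ₃`, and `F₃ = S^{3/2}/√6` iff `λ₁ = λ₂`. -/
theorem cube_sum_extremal_iff (l1 l2 l3 : ℝ) (h12 : l1 ≤ l2) (h23 : l2 ≤ l3)
    (hsum : l1 + l2 + l3 = 0) (hS : 0 < l1 ^ 2 + l2 ^ 2 + l3 ^ 2) :
    (l1 ^ 3 + l2 ^ 3 + l3 ^ 3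
        = -((l1 ^ 2 + l2 ^ 2 + l3 ^ 2) ^ ((3 : ℝ) / 2)) / Real.sqrt 6 ↔ l2 = l3) ∧
    (l1 ^ 3 + l2 ^ 3 + l3 ^ 3
        = (l1 ^ 2 + l2 ^ 2 + l3 ^ 2) ^ ((3 : ℝ) / 2) / Real.sqrt 6 ↔ l1 = l2) := by
  have hT : 0 < (l1 ^ 2 + l2 ^ 2 + l3 ^ 2) ^ ((3 : ℝ) / 2) / Real.sqrt 6 := by positivity
  have hT2 := rpow_three_halves_div_sqrt_six_sq hS.le
  have hdisc := sq_sum_cubed_sub_six_mul_cube_sum_sq hsum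
  rw [neg_div]
  generalize (l1 ^ 2 + l2 ^ 2 + l3 ^ 2) ^ ((3 : ℝ) / 2) / Real.sqrt 6 = T at hT hT2 ⊢
  have hF12 : l1 = l2 → 0 ≤ l1 ^ 3 + l2 ^ 3 + l3 ^ 3 := by
    rintro rfl
    obtain rfl : l3 = -2 * l1 := by linarith
    have := pow_nonneg (show 0 ≤ -l1 by linarith) 3
    linarith [show (-l1) ^ 3 = -l1 ^ 3 by ring, show (-2 * l1) ^ 3 = -8 * l1 ^ 3 by ring]
  have hF23 : l2 = l3 → l1 ^ 3 + l2 ^ 3 + l3 ^ 3 ≤ 0 := by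
    rintro rfl
    obtain rfl : l1 = -2 * l2 := by linarith
    have := pow_nonneg (show 0 ≤ l2 by linarith) 3
    linarith [show (-2 * l2) ^ 3 = -8 * l2 ^ 3 by ring]
  generalize l1 ^ 3 + l2 ^ 3 + l3 ^ 3 = F at *
  have hsq : F ^ 2 = T ^ 2 ↔ l1 = l2 ∨ l2 = l3 := by
    constructor
    · intro h
      have h0 : ((l1 - l2) * (l2 - l3) * (l1 - l3)) ^ 2 = 0 := by linarith
      simp only [sq_eq_zero_iff, mul_eq_zero, sub_eq_zero] at h0
      rcases h0 with h0 | h0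
      · exact h0
      · left; linarith
    · intro h
      have h0 : (l1 - l2) * (l2 - l3) * (l1 - l3) = 0 := by
        rcases h with rfl | rfl <;> ring
      rw [h0] at hdisc
      linarith
  refine ⟨⟨fun h => ?_, fun h => ?_⟩, ⟨fun h => ?_, fun h => ?_⟩⟩
  · refine (hsq.1 (by rw [h, neg_sq])).resolve_left fun h12 => ?_
    linarith [hF12 h12]
  · rcases sq_eq_sq_iff_eq_or_eq_neg.1 (hsq.2 (.inr h)) with hF | hF
    · linarith [hF23 h]
    · exact hF
  · refine (hsq.1 (by rw [h])).resolve_right fun h23 => ?_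
    linarith [hF23 h23]
  · rcases sq_eq_sq_iff_eq_or_eq_neg.1 (hsq.2 (.inl h)) with hF | hF
    · exact hF
    · linarith [hF12 h]
end

section
/- Let E be a real symmetric 3×3 matrix with trace zero, let a ∈ ℝ³, and let D_{ijk} = 2(E_{ik} a_j − E_{ij} a_k) + Σ_l (E_{lj} δ_{ik} − E_{lk} δ_{ij}) a_l. Then Σ_{i,j,k} D_{ijk}² = 8·S·|a|² − 12·Σ_{i,j,k} E_{ik}E_{kj}a_i a_j, where S = Σ_{i,j} E_{ij}² and |a|² = Σᵢ aᵢ². -/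
/-- For a real symmetric trace-free `3 × 3` matrix `E`, a vector `a ∈ ℝ³`, and
`D_{ijk} = 2(E_{ik}a_j − E_{ij}a_k) + Σ_l (E_{lj}δ_{ik} − E_{lk}δ_{ij})a_l`, one has
`Σ D_{ijk}² = 8·S·|a|² − 12·Σ E_{ik}E_{kj}a_i a_j` with `S = Σ E_{ij}²`. -/
theorem sum_D_sq (E : Matrix (Fin 3) (Fin 3) ℝ) (hsymm : E.IsSymm)
    (htr : E.trace = 0) (a : Fin 3 → ℝ) (D : Fin 3 → Fin 3 → Fin 3 → ℝ)
    (hD : ∀ i j k, D i j k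
      = 2 * (E i k * a j - E i j * a k)
        + ∑ l, (E l j * (if i = k then (1 : ℝ) else 0)
            - E l k * (if i = j then (1 : ℝ) else 0)) * a l) :
    (∑ i, ∑ j, ∑ k, (D i j k) ^ 2)
      = 8 * (∑ i, ∑ j, (E i j) ^ 2) * (∑ i, (a i) ^ 2)
        - 12 * (∑ i, ∑ j, ∑ k, E i k * E k j * a i * a j) := by
  have h10 : E 1 0 = E 0 1 := hsymm.apply 0 1
  have h20 : E 2 0 = E 0 2 := hsymm.apply 0 2
  have h21 : E 2 1 = E 1 2 := hsymm.apply 1 2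
  have h22 : E 2 2 = -E 0 0 - E 1 1 := by
    rw [Matrix.trace_fin_three] at htr
    linarith
  simp only [hD, Fin.sum_univ_three, Fin.isValue, Fin.reduceEq, if_true, if_false,
    h10, h20, h21, h22]
  ring
end

section
/- Let E be a real symmetric 3×3 matrix with trace zero, let a ∈ ℝ³, and let D_{ijk} = 2(E_{ik} a_j − E_{ij} a_k) + Σ_l (E_{lj} δ_{ik} − E_{lk} δ_{ij}) a_l. Then 4·Σ_{i,j,k} E_{ij} D_{ijk} a_k = −Σ_{i,j,k} D_{ijk}². -/
/-- For a real symmetric trace-free `3 × 3` matrix `E`, a vector `a ∈ ℝ³`, and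
`D_{ijk} = 2(E_{ik}a_j − E_{ij}a_k) + Σ_l (E_{lj}δ_{ik} − E_{lk}δ_{ij})a_l`, one has
`4·Σ E_{ij}D_{ijk}a_k = −Σ D_{ijk}²`. -/
theorem four_sum_E_D_a_eq_neg_sum_D_sq (E : Matrix (Fin 3) (Fin 3) ℝ)
    (hsymm : E.IsSymm) (htr : E.trace = 0) (a : Fin 3 → ℝ)
    (D : Fin 3 → Fin 3 → Fin 3 → ℝ)
    (hD : ∀ i j k, D i j k
      = 2 * (E i k * a j - E i j * a k)
        + ∑ l, (E l j * (if i = k then (1 : ℝ) else 0)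
            - E l k * (if i = j then (1 : ℝ) else 0)) * a l) :
    4 * (∑ i, ∑ j, ∑ k, E i j * D i j k * a k)
      = -(∑ i, ∑ j, ∑ k, (D i j k) ^ 2) := by
  have h10 : E 1 0 = E 0 1 := hsymm.apply 0 1
  have h20 : E 2 0 = E 0 2 := hsymm.apply 0 2
  have h21 : E 2 1 = E 1 2 := hsymm.apply 1 2
  have h22 : E 2 2 = -E 0 0 - E 1 1 := by
    rw [Matrix.trace_fin_three] at htr
    linarith
  simp only [hD, Fin.sum_univ_three, Fin.isValue, Fin.reduceEq, if_true, if_false,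
    h10, h20, h21, h22]
  ring
end
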